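/- Let α, θ₁, θ₂ be real numbers. A double-[α,θ₁,θ₂]-defined function exists if and only if either (i) α = θ₁ = θ₂ = 0, or (ii) θ₁·θ₂ > 0, 0 < |4α| ≤ min(|θ₁|,|θ₂|), and sgn(α) = sgn(θ₁). Moreover, when such a function exists it is unique. -/

import Mathlib

open Set

/-- The function `Elastic α d₁ d₂` on `[0,1]`. -/
noncomputable def Elastic (α d₁ d₂ : ℝ) : ℝ → ℝ := fun x =>
  if x ≤ 1/2 then α * (1 - (2*x - 1)^2 * Real.exp (-2*d₁*x))
  else α * (1 - (2*x - 1)^2 * Real.exp (-2*d₂*(1-x)))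

/-- `C : [0,1] → ℝ` is single-`[α,θ₁,θ₂]`-defined: it belongs to the `[α]`-elastic
family and its one-sided derivatives at the endpoints are `θ₁` and `θ₂`. -/
def IsSingleDefined (α θ₁ θ₂ : ℝ) (C : ℝ → ℝ) : Prop :=
  (∃ d₁ d₂ : ℝ, 0 ≤ d₁ ∧ 0 ≤ d₂ ∧ ∀ x ∈ Icc (0:ℝ) 1, C x = Elastic α d₁ d₂ x) ∧
  derivWithin C (Icc 0 1) 0 = θ₁ ∧ derivWithin C (Icc 0 1) 1 = θ₂

/-- `C : [0,1] → ℝ` is double-`[α,θ₁,θ₂]`-defined, with middle slope `θ = -4α`. -/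
def IsDoubleDefined (α θ₁ θ₂ : ℝ) (C : ℝ → ℝ) : Prop :=
  ∃ C₁ C₂ : ℝ → ℝ,
    IsSingleDefined (α/2) (θ₁/2) ((-4*α)/2) C₁ ∧
    IsSingleDefined (-α/2) ((-4*α)/2) (θ₂/2) C₂ ∧
    ∀ x ∈ Icc (0:ℝ) 1, C x = if x ≤ 1/2 then C₁ (2*x) else C₂ (2*x - 1)

theorem pos_of_sign_eq_one {r : ℝ} (h : Real.sign r = 1) : 0 < r := by
  rcases lt_trichotomy r 0 with hr | rfl | hr
  · norm_num [Real.sign_of_neg hr] at h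
  · norm_num at h
  · exact hr

theorem derivWithin_elastic_zero (α d₁ d₂ : ℝ) :
    derivWithin (Elastic α d₁ d₂) (Icc 0 1) 0 = α * (4 + 2 * d₁) := by
  have h : HasDerivAt (fun x : ℝ => α * (1 - (2*x - 1)^2 * Real.exp (-2*d₁*x)))
      (α * (4 + 2 * d₁)) 0 := by
    have h₁ : HasDerivAt (fun x : ℝ => (2*x - 1)^2) (-4) 0 := by
      refine ((((hasDerivAt_id (0:ℝ)).const_mul 2).sub_const 1).pow 2).congr_deriv ?_
      norm_num
    have h₂ : HasDerivAt (fun x : ℝ => Real.exp (-2*d₁*x)) (-2*d₁) 0 := by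
      refine (((hasDerivAt_id (0:ℝ)).const_mul (-2*d₁)).exp).congr_deriv ?_
      simp
    refine (((h₁.mul h₂).const_sub 1).const_mul α).congr_deriv ?_
    simp only [mul_zero, Real.exp_zero]
    ring
  have h' : HasDerivAt (Elastic α d₁ d₂) (α * (4 + 2 * d₁)) 0 := by
    refine h.congr_of_eventuallyEq ?_
    filter_upwards [Iio_mem_nhds (show (0:ℝ) < 1/2 by norm_num)] with x hx
    exact if_pos (le_of_lt hx)
  exact h'.hasDerivWithinAt.derivWithin
    (uniqueDiffOn_Icc zero_lt_one 0 (left_mem_Icc.2 zero_le_one))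

theorem derivWithin_elastic_one (α d₁ d₂ : ℝ) :
    derivWithin (Elastic α d₁ d₂) (Icc 0 1) 1 = -α * (4 + 2 * d₂) := by
  have h : HasDerivAt (fun x : ℝ => α * (1 - (2*x - 1)^2 * Real.exp (-2*d₂*(1-x))))
      (-α * (4 + 2 * d₂)) 1 := by
    have h₁ : HasDerivAt (fun x : ℝ => (2*x - 1)^2) 4 1 := by
      refine ((((hasDerivAt_id (1:ℝ)).const_mul 2).sub_const 1).pow 2).congr_deriv ?_
      norm_num
    have h₂ : HasDerivAt (fun x : ℝ => Real.exp (-2*d₂*(1-x))) (2*d₂) 1 := by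
      refine ((((hasDerivAt_id (1:ℝ)).const_sub 1).const_mul (-2*d₂)).exp).congr_deriv ?_
      simp
    refine (((h₁.mul h₂).const_sub 1).const_mul α).congr_deriv ?_
    simp only [mul_zero, sub_self, Real.exp_zero]
    ring
  have h' : HasDerivAt (Elastic α d₁ d₂) (-α * (4 + 2 * d₂)) 1 := by
    refine h.congr_of_eventuallyEq ?_
    filter_upwards [Ioi_mem_nhds (show (1/2:ℝ) < 1 by norm_num)] with x hx
    exact if_neg (not_le_of_gt hx)
  exact h'.hasDerivWithinAt.derivWithin
    (uniqueDiffOn_Icc zero_lt_one 1 (right_mem_Icc.2 zero_le_one))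

theorem isSingleDefined_iff (α θ₁ θ₂ : ℝ) (C : ℝ → ℝ) :
    IsSingleDefined α θ₁ θ₂ C ↔
      ∃ d₁ d₂ : ℝ, 0 ≤ d₁ ∧ 0 ≤ d₂ ∧ EqOn C (Elastic α d₁ d₂) (Icc 0 1) ∧
        α * (4 + 2 * d₁) = θ₁ ∧ -α * (4 + 2 * d₂) = θ₂ := by
  have key : ∀ d₁ d₂ : ℝ, EqOn C (Elastic α d₁ d₂) (Icc 0 1) →
      derivWithin C (Icc 0 1) 0 = α * (4 + 2 * d₁) ∧
      derivWithin C (Icc 0 1) 1 = -α * (4 + 2 * d₂) := fun d₁ d₂ h =>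
    ⟨(derivWithin_congr h (h (left_mem_Icc.2 zero_le_one))).trans
      (derivWithin_elastic_zero α d₁ d₂),
    (derivWithin_congr h (h (right_mem_Icc.2 zero_le_one))).trans
      (derivWithin_elastic_one α d₁ d₂)⟩
  constructor
  · rintro ⟨⟨d₁, d₂, h₁, h₂, h⟩, e₁, e₂⟩
    obtain ⟨k₁, k₂⟩ := key d₁ d₂ h
    exact ⟨d₁, d₂, h₁, h₂, h, k₁.symm.trans e₁, k₂.symm.trans e₂⟩
  · rintro ⟨d₁, d₂, h₁, h₂, h, e₁, e₂⟩
    obtain ⟨k₁, k₂⟩ := key d₁ d₂ h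
    exact ⟨⟨d₁, d₂, h₁, h₂, h⟩, k₁.trans e₁, k₂.trans e₂⟩

theorem IsSingleDefined.eqOn {α θ₁ θ₂ : ℝ} {C D : ℝ → ℝ}
    (hC : IsSingleDefined α θ₁ θ₂ C) (hD : IsSingleDefined α θ₁ θ₂ D) :
    EqOn C D (Icc 0 1) := by
  obtain ⟨c₁, c₂, -, -, hc, hc₁, hc₂⟩ := (isSingleDefined_iff _ _ _ _).1 hC
  obtain ⟨d₁, d₂, -, -, hd, hd₁, hd₂⟩ := (isSingleDefined_iff _ _ _ _).1 hD
  refine hc.trans (EqOn.trans ?_ hd.symm)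
  intro x _
  rcases eq_or_ne α 0 with rfl | hα
  · simp [Elastic]
  · have e₁ := mul_left_cancel₀ hα (hc₁.trans hd₁.symm)
    have e₂ := mul_left_cancel₀ (neg_ne_zero.2 hα) (hc₂.trans hd₂.symm)
    rw [show c₁ = d₁ by linarith, show c₂ = d₂ by linarith]

theorem IsDoubleDefined.eqOn {α θ₁ θ₂ : ℝ} {C D : ℝ → ℝ}
    (hC : IsDoubleDefined α θ₁ θ₂ C) (hD : IsDoubleDefined α θ₁ θ₂ D) :
    EqOn C D (Icc 0 1) := by
  obtain ⟨C₁, C₂, hC₁, hC₂, hC⟩ := hC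
  obtain ⟨D₁, D₂, hD₁, hD₂, hD⟩ := hD
  intro x hx
  rw [hC x hx, hD x hx]
  split_ifs with h
  · exact hC₁.eqOn hD₁ ⟨by linarith [hx.1], by linarith⟩
  · exact hC₂.eqOn hD₂ ⟨by linarith, by linarith [hx.2]⟩

theorem exists_isDoubleDefined_iff (α θ₁ θ₂ : ℝ) :
    (∃ C : ℝ → ℝ, IsDoubleDefined α θ₁ θ₂ C) ↔
      ∃ d₁ d₂ : ℝ, 0 ≤ d₁ ∧ 0 ≤ d₂ ∧ θ₁ = α * (4 + 2 * d₁) ∧ θ₂ = α * (4 + 2 * d₂) := by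
  constructor
  · rintro ⟨C, C₁, C₂, h₁, h₂, -⟩
    obtain ⟨d₁, -, hd₁, -, -, e₁, -⟩ := (isSingleDefined_iff _ _ _ _).1 h₁
    obtain ⟨-, d₂, -, hd₂, -, -, e₂⟩ := (isSingleDefined_iff _ _ _ _).1 h₂
    exact ⟨d₁, d₂, hd₁, hd₂, by linarith, by linarith⟩
  · rintro ⟨d₁, d₂, hd₁, hd₂, e₁, e₂⟩
    refine ⟨_, Elastic (α/2) d₁ 0, Elastic (-α/2) 0 d₂, ?_, ?_, fun x _ => rfl⟩
    · exact (isSingleDefined_iff _ _ _ _).2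
        ⟨d₁, 0, hd₁, le_rfl, fun _ _ => rfl, by rw [e₁]; ring, by ring⟩
    · exact (isSingleDefined_iff _ _ _ _).2
        ⟨0, d₂, le_rfl, hd₂, fun _ _ => rfl, by ring, by rw [e₂]; ring⟩

theorem exists_eq_mul_of_pos {α θ : ℝ} (hα : 0 < α) (h : 4 * α ≤ θ) :
    ∃ d : ℝ, 0 ≤ d ∧ θ = α * (4 + 2 * d) :=
  ⟨(θ - 4 * α) / (2 * α), div_nonneg (by linarith) (by linarith), by field_simp; ring⟩

theorem exists_eq_mul_of_neg {α θ : ℝ} (hα : α < 0) (h : θ ≤ 4 * α) :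
    ∃ d : ℝ, 0 ≤ d ∧ θ = α * (4 + 2 * d) := by
  obtain ⟨d, hd, e⟩ := exists_eq_mul_of_pos (neg_pos.2 hα) (show 4 * -α ≤ -θ by linarith)
  exact ⟨d, hd, by linarith⟩

theorem doubleDefined_existence_uniqueness (α θ₁ θ₂ : ℝ) :
    ((∃ C : ℝ → ℝ, IsDoubleDefined α θ₁ θ₂ C) ↔
      (α = 0 ∧ θ₁ = 0 ∧ θ₂ = 0) ∨
      (θ₁ * θ₂ > 0 ∧ 0 < |4*α| ∧ |4*α| ≤ min |θ₁| |θ₂| ∧ Real.sign α = Real.sign θ₁)) ∧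
    (∀ C₁ C₂ : ℝ → ℝ, IsDoubleDefined α θ₁ θ₂ C₁ → IsDoubleDefined α θ₁ θ₂ C₂ →
      ∀ x ∈ Icc (0:ℝ) 1, C₁ x = C₂ x) := by
  refine ⟨?_, fun C D hC hD x hx => hC.eqOn hD hx⟩
  rw [exists_isDoubleDefined_iff]
  constructor
  · rintro ⟨d₁, d₂, hd₁, hd₂, rfl, rfl⟩
    rcases eq_or_ne α 0 with rfl | hα
    · left; simp
    · right
      have p₁ : 0 < 4 + 2 * d₁ := by linarith
      have p₂ : 0 < 4 + 2 * d₂ := by linarith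
      refine ⟨?_, by positivity, le_min ?_ ?_, ?_⟩
      · have : 0 < α ^ 2 * ((4 + 2 * d₁) * (4 + 2 * d₂)) := by positivity
        linarith
      · rw [abs_mul, abs_mul, abs_of_pos p₁, abs_of_pos (four_pos : (0:ℝ) < 4)]
        nlinarith [abs_nonneg α]
      · rw [abs_mul, abs_mul, abs_of_pos p₂, abs_of_pos (four_pos : (0:ℝ) < 4)]
        nlinarith [abs_nonneg α]
      · rcases hα.lt_or_gt with h | h
        · rw [Real.sign_of_neg h, Real.sign_of_neg (mul_neg_of_neg_of_pos h p₁)]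
        · rw [Real.sign_of_pos h, Real.sign_of_pos (mul_pos h p₁)]
  · rintro (⟨rfl, rfl, rfl⟩ | ⟨hθ, hα, hmin, hs⟩)
    · exact ⟨0, 0, le_rfl, le_rfl, by simp, by simp⟩
    · obtain ⟨m₁, m₂⟩ := le_min_iff.1 hmin
      rcases pos_and_pos_or_neg_and_neg_of_mul_pos hθ with ⟨t₁, t₂⟩ | ⟨t₁, t₂⟩
      · replace hs : 0 < α := pos_of_sign_eq_one (hs.trans (Real.sign_of_pos t₁))
        rw [abs_of_pos (by linarith), abs_of_pos t₁] at m₁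
        rw [abs_of_pos (by linarith), abs_of_pos t₂] at m₂
        obtain ⟨d₁, h₁, e₁⟩ := exists_eq_mul_of_pos hs m₁
        obtain ⟨d₂, h₂, e₂⟩ := exists_eq_mul_of_pos hs m₂
        exact ⟨d₁, d₂, h₁, h₂, e₁, e₂⟩
      · replace hs : α < 0 := by
          refine neg_pos.1 (pos_of_sign_eq_one ?_)
          rw [Real.sign_neg, hs, Real.sign_of_neg t₁, neg_neg]
        rw [abs_of_neg (by linarith), abs_of_neg t₁] at m₁
        rw [abs_of_neg (by linarith), abs_of_neg t₂] at m₂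
        obtain ⟨d₁, h₁, e₁⟩ := exists_eq_mul_of_neg hs (neg_le_neg_iff.1 m₁)
        obtain ⟨d₂, h₂, e₂⟩ := exists_eq_mul_of_neg hs (neg_le_neg_iff.1 m₂)
        exact ⟨d₁, d₂, h₁, h₂, e₁, e₂⟩
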